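/- Let n ≥ 1, let w : Fin (n+1) → ℕ with w i > 0 for all i, and let s be a nonempty subset (finset) of Fin (n+1) with Finset.gcd s w = 1; write m + 1 = s.card. Consider the additive submonoid M of (Fin (n+1) → ℤ) consisting of all v such that v i ≥ 0 for every i ∉ s and ∑ i, (w i : ℤ) * v i = 0. Then M is isomorphic, as an additive monoid, to (Fin m → ℤ) × (Fin (n − m) → ℕ). -/

import Mathlib

/-- The additive monoid of exponent vectors of Laurent monomials of weighted
degree zero, where only the variables indexed by `s` may occur with negative
exponents. -/
def degreeZeroExponentMonoid (n : ℕ) (w : Fin (n + 1) → ℕ)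
    (s : Finset (Fin (n + 1))) : AddSubmonoid (Fin (n + 1) → ℤ) where
  carrier := {v | (∀ i ∉ s, 0 ≤ v i) ∧ ∑ i, (w i : ℤ) * v i = 0}
  zero_mem' := by simp
  add_mem' := by
    rintro u v ⟨hu1, hu2⟩ ⟨hv1, hv2⟩
    refine ⟨fun i hi => ?_, ?_⟩
    · have := hu1 i hi
      have := hv1 i hi
      simpa using by omega
    · simp only [Pi.add_apply, mul_add, Finset.sum_add_distrib, hu2, hv2, add_zero]

theorem Finset.sum_coe_add_sum_notMem {ι M : Type*} [Fintype ι] [DecidableEq ι] [AddCommMonoid M]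
    (s : Finset ι) (f : ι → M) :
    ∑ i : s, f i + ∑ i : {i // i ∉ s}, f i = ∑ i, f i := by
  rw [← Fintype.sum_subtype_add_sum_subtype (· ∈ s) f]
  congr!

theorem Finset.exists_sum_mul_eq_one_of_gcd_eq_one {ι : Type*} (s : Finset ι) (w : ι → ℕ)
    (h : s.gcd w = 1) : ∃ a : ι → ℤ, ∑ i ∈ s, (w i : ℤ) * a i = 1 := by
  obtain ⟨a, ha⟩ := Finset.gcd_eq_sum_mul s (fun i => (w i : ℤ))
  have hunit : IsUnit (s.gcd fun i => (w i : ℤ)) := by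
    rw [Int.isUnit_iff_natAbs_eq, ← Nat.dvd_one, ← h]
    exact Finset.dvd_gcd fun i hi => by
      simpa using Int.natAbs_dvd_natAbs.mpr (Finset.gcd_dvd (f := fun i => (w i : ℤ)) hi)
  have hone : s.gcd (fun i => (w i : ℤ)) = 1 := by
    rw [← Finset.normalize_gcd]
    exact normalize_eq_one.mpr hunit
  exact ⟨a, by rw [← ha, hone]⟩

/-- The weighted degree, as a linear functional on exponent vectors. -/
def weightedDegree {ι : Type*} [Fintype ι] (w : ι → ℕ) : (ι → ℤ) →ₗ[ℤ] ℤ where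
  toFun x := ∑ i, (w i : ℤ) * x i
  map_add' x y := by simp only [Pi.add_apply, mul_add, Finset.sum_add_distrib]
  map_smul' c x := by
    simp only [Pi.smul_apply, smul_eq_mul, RingHom.id_apply, Finset.mul_sum]
    exact Finset.sum_congr rfl fun i _ => by ring

theorem weightedDegree_apply {ι : Type*} [Fintype ι] (w : ι → ℕ) (x : ι → ℤ) :
    weightedDegree w x = ∑ i, (w i : ℤ) * x i := rfl

theorem finrank_ker_add_one_of_surjective {ι : Type*} [Fintype ι] (f : (ι → ℤ) →ₗ[ℤ] ℤ)
    (hf : Function.Surjective f) :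
    Module.finrank ℤ (LinearMap.ker f) + 1 = Fintype.card ι := by
  have h := Submodule.finrank_quotient_add_finrank (LinearMap.ker f)
  rw [(f.quotKerEquivOfSurjective hf).finrank_eq, Module.finrank_self,
    Module.finrank_fintype_fun_eq_card] at h
  omega

/-- Given a vector `a` supported on `s` of weighted degree one, a degree-zero exponent vector
on `s` and arbitrary nonnegative exponents off `s` combine to a degree-zero exponent vector. -/
def degreeZeroExponentMonoidOfProd (n : ℕ) (w : Fin (n + 1) → ℕ) (s : Finset (Fin (n + 1)))
    (a : s → ℤ) (ha : weightedDegree (fun i : s => w i) a = 1) :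
    LinearMap.ker (weightedDegree fun i : s => w i) × ({i // i ∉ s} → ℕ) →+
      degreeZeroExponentMonoid n w s where
  toFun p := ⟨fun i => if h : i ∈ s then
      p.1.1 ⟨i, h⟩ - (∑ j : {i // i ∉ s}, (w j : ℤ) * p.2 j) * a ⟨i, h⟩
      else p.2 ⟨i, h⟩, by
    refine ⟨fun i hi => by simp [hi], ?_⟩
    rw [← s.sum_coe_add_sum_notMem]
    have h0 : ∑ i : s, (w i : ℤ) * p.1.1 i = 0 := p.1.2
    have h1 : ∑ i : s, (w i : ℤ) * a i = 1 := ha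
    have h2 : ∀ c : ℤ, ∑ i : s, (w i : ℤ) * (p.1.1 i - c * a i) = -c := fun c => by
      simp only [mul_sub, Finset.sum_sub_distrib, h0, mul_left_comm _ c, ← Finset.mul_sum, h1]
      ring
    have h3 : ∀ i : {i // i ∉ s}, (i : Fin (n + 1)) ∉ s := fun i => i.2
    have h4 : ∀ i : s, (i : Fin (n + 1)) ∈ s := fun i => i.2
    simp only [h3, h4, dite_true, dite_false, Subtype.coe_eta]
    rw [h2]
    ring⟩
  map_zero' := by
    ext i
    by_cases h : i ∈ s <;> simp [h]
  map_add' p q := by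
    ext i
    by_cases h : i ∈ s
    · simp [h, mul_add, add_mul, Finset.sum_add_distrib]
      ring
    · simp [h]

theorem degreeZeroExponentMonoidOfProd_bijective (n : ℕ) (w : Fin (n + 1) → ℕ)
    (s : Finset (Fin (n + 1))) (a : s → ℤ) (ha : weightedDegree (fun i : s => w i) a = 1) :
    Function.Bijective (degreeZeroExponentMonoidOfProd n w s a ha) := by
  constructor
  · rintro ⟨⟨k, hk⟩, u⟩ ⟨⟨l, hl⟩, v⟩ h
    have h' := fun i => congrFun (congrArg Subtype.val h) i
    simp only [degreeZeroExponentMonoidOfProd, AddMonoidHom.coe_mk, ZeroHom.coe_mk] at h'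
    have huv : u = v := funext fun i => by simpa [i.2] using h' i
    subst huv
    have hkl : k = l := funext fun i => by simpa [i.2] using h' i
    subst hkl
    rfl
  · rintro ⟨v, hv, hsum⟩
    have hnn : ∀ i : {i // i ∉ s}, ((v i).toNat : ℤ) = v i :=
      fun i => Int.toNat_of_nonneg (hv i i.2)
    rw [← s.sum_coe_add_sum_notMem] at hsum
    refine ⟨(⟨(fun i : s => v i) + (∑ j : {i // i ∉ s}, (w j : ℤ) * v j) • a, ?_⟩,
      fun i => (v i).toNat), ?_⟩
    · rw [LinearMap.mem_ker, map_add, map_smul, ha, weightedDegree_apply, smul_eq_mul, mul_one]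
      exact hsum
    · ext i
      by_cases h : i ∈ s
      · simp only [degreeZeroExponentMonoidOfProd, AddMonoidHom.coe_mk, ZeroHom.coe_mk, h,
          dite_true, hnn, Pi.add_apply, Pi.smul_apply, smul_eq_mul, add_sub_cancel_right]
      · simpa [degreeZeroExponentMonoidOfProd, h] using hv i h

theorem stmt_13 (n : ℕ) (hn : 1 ≤ n) (w : Fin (n + 1) → ℕ)
    (hw : ∀ i, 0 < w i) (s : Finset (Fin (n + 1))) (hs : s.Nonempty)
    (hgcd : Finset.gcd s w = 1) (m : ℕ) (hm : m + 1 = s.card) :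
    Nonempty
      (degreeZeroExponentMonoid n w s ≃+ ((Fin m → ℤ) × (Fin (n - m) → ℕ))) := by
  obtain ⟨b, hb⟩ := s.exists_sum_mul_eq_one_of_gcd_eq_one w hgcd
  have ha : weightedDegree (fun i : s => w i) (fun i => b i) = 1 := by
    rw [weightedDegree_apply, ← hb]
    exact Finset.sum_coe_sort s fun i => (w i : ℤ) * b i
  have hsurj : Function.Surjective (weightedDegree fun i : s => w i) := fun c =>
    ⟨c • fun i : s => b i, by rw [map_smul, ha, smul_eq_mul, mul_one]⟩
  have hrank : Module.finrank ℤ (LinearMap.ker (weightedDegree fun i : s => w i)) = m := by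
    have h := finrank_ker_add_one_of_surjective _ hsurj
    rw [Fintype.card_coe] at h
    omega
  have hcard : Fintype.card {i // i ∉ s} = n - m := by
    rw [Fintype.card_subtype_compl, Fintype.card_fin, Fintype.card_coe]
    omega
  let eker := (Module.finBasisOfFinrankEq ℤ _ hrank).equivFun.toAddEquiv
  let ecompl : ({i // i ∉ s} → ℕ) ≃+ (Fin (n - m) → ℕ) :=
    (LinearEquiv.funCongrLeft ℕ ℕ (Fintype.equivFinOfCardEq hcard).symm).toAddEquiv
  exact ⟨(AddEquiv.ofBijective _
    (degreeZeroExponentMonoidOfProd_bijective n w s _ ha)).symm.trans (eker.prodCongr ecompl)⟩
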